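/- Let d ≥ 0 and let x ∈ {0,1}^(4^(d+1)) be A-winnable (i.e., NAND_{2(d+1)}(x) = 1), with root node r and consecutive quarters x^{00}, x^{01}, x^{10}, x^{11} ∈ {0,1}^(4^d). Then the average choice complexity satisfies C_A(x) = (1/2) · c(r) · min over b ∈ {0,1} of (C_A(x^{b0}) + C_A(x^{b1})), where the minimum and sums are taken in (0,∞]. -/

import Mathlib

open scoped ENNReal
open scoped Classical

namespace NandTree

/-- The bit-`b` half of an input of length `2^(m+1)`: `b = false` gives the first half,
`b = true` the second half (lexicographic indexing, first bit most significant). -/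
def halfInput (m : ℕ) (b : Bool) (x : Fin (2^(m+1)) → Bool) : Fin (2^m) → Bool :=
  fun i => x ⟨(cond b 1 0) * 2^m + i.val, by
    have h := i.isLt
    have h2 : (2:ℕ)^(m+1) = 2^m * 2 := pow_succ 2 m
    cases b <;> simp only [cond_true, cond_false] <;> omega⟩

/-- The value `NAND_ℓ(x)` of a depth-`ℓ` NAND-tree instance: internal nodes at even
distance from the leaves are OR gates, at odd distance AND gates. -/
def nand : (ℓ : ℕ) → (Fin (2^ℓ) → Bool) → Bool
  | 0, x => x ⟨0, by norm_num⟩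
  | (ℓ+1), x =>
    if (ℓ+1) % 2 = 0 then
      nand ℓ (halfInput ℓ false x) || nand ℓ (halfInput ℓ true x)
    else
      nand ℓ (halfInput ℓ false x) && nand ℓ (halfInput ℓ true x)

/-- Index of a leaf given by a root-to-leaf bit string (lexicographic, first bit most
significant). -/
def leafIdx (s : List Bool) : ℕ := s.foldl (fun n b => 2 * n + cond b 1 0) 0

/-- The value of the leaf reached by bit string `s` in instance `x`. -/
def leafVal (m : ℕ) (x : Fin (2^m) → Bool) (s : List Bool) : Bool :=
  if h : leafIdx s < 2^m then x ⟨leafIdx s, h⟩ else false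

/-- The root-to-leaf path determined by strategies `σA`, `σB` (each assigning a choice of
child to every node, nodes being given by the list of choices from the root): at a node
at distance `m+1` from the leaves, Player A chooses a child if `m+1` is even, else
Player B chooses. -/
def gamePath (σA σB : List Bool → Bool) : (m : ℕ) → List Bool → List Bool
  | 0, p => p
  | (m+1), p => gamePath σA σB m (p ++ [if (m+1) % 2 = 0 then σA p else σB p])

/-- `winning Z m x σ`: strategy `σ` is a winning strategy for player `Z` (`true` = A,
`false` = B) in the two-player game on the depth-`m` instance `x`: against every
opponent strategy, the reached leaf has value `Z` (A wins on `1 = true`, B on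
`0 = false`). -/
def winning (Z : Bool) (m : ℕ) (x : Fin (2^m) → Bool) (σ : List Bool → Bool) : Prop :=
  ∀ τ : List Bool → Bool,
    leafVal m x (gamePath (if Z then σ else τ) (if Z then τ else σ) m []) = Z

mutual

/-- The criticality `c(v)` of the root of a depth-`m` subtree with input `y`. -/
noncomputable def crit : (m : ℕ) → (Fin (2^m) → Bool) → ℝ≥0∞
  | 0, _ => 1
  | 1, y => if y ⟨0, by norm_num⟩ = y ⟨1, by norm_num⟩ then 1 else 2
  | (m+2), y =>
    if nand (m+2) y ≠ decide ((m+2) % 2 = 0) then 1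
    else if nand (m+1) (halfInput (m+1) false y) ≠ nand (m+1) (halfInput (m+1) true y) then 2
    else
      (max (CZ (decide ((m+2) % 2 = 0)) m (halfInput m false (halfInput (m+1) false y)) +
            CZ (decide ((m+2) % 2 = 0)) m (halfInput m true (halfInput (m+1) false y)))
           (CZ (decide ((m+2) % 2 = 0)) m (halfInput m false (halfInput (m+1) true y)) +
            CZ (decide ((m+2) % 2 = 0)) m (halfInput m true (halfInput (m+1) true y)))) /
      (((CZ (decide ((m+2) % 2 = 0)) m (halfInput m false (halfInput (m+1) false y)) +
         CZ (decide ((m+2) % 2 = 0)) m (halfInput m true (halfInput (m+1) false y))) +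
        ((CZ (decide ((m+2) % 2 = 0)) m (halfInput m false (halfInput (m+1) true y)) +
          CZ (decide ((m+2) % 2 = 0)) m (halfInput m true (halfInput (m+1) true y))))) / 2)
termination_by m _ => (m, 0)

/-- The expected product, over the random choices of `Z`'s opponent, of the criticalities
of the nodes at which `Z` moves along the path played according to strategy `σ`. -/
noncomputable def pathProd (Z : Bool) :
    (σ : List Bool → Bool) → (m : ℕ) → (Fin (2^m) → Bool) → ℝ≥0∞
  | _, 0, _ => 1
  | σ, (m+1), y =>
    if decide ((m+1) % 2 = 0) = Z then
      crit (m+1) y * pathProd Z (fun q => σ (σ [] :: q)) m (halfInput m (σ []) y)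
    else
      (pathProd Z (fun q => σ (false :: q)) m (halfInput m false y) +
       pathProd Z (fun q => σ (true :: q)) m (halfInput m true y)) / 2
termination_by _ m _ => (m, 1)

/-- The average choice complexity `C_Z` of a depth-`m` instance `y` for player `Z`
(`true` = A, `false` = B): the infimum, over `Z`-winning strategies, of the expected
product of criticalities over the nodes where `Z` moves (and `∞` if `Z` has no winning
strategy, the infimum over the empty set being `⊤`). -/
noncomputable def CZ (Z : Bool) (m : ℕ) (y : Fin (2^m) → Bool) : ℝ≥0∞ :=
  ⨅ σ ∈ {σ : List Bool → Bool | winning Z m y σ}, pathProd Z σ m y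
termination_by (m, 2)

end

theorem gamePath_cons (σ τ : List Bool → Bool) (b : Bool) : ∀ (m : ℕ) (p : List Bool),
    gamePath σ τ m (b :: p) =
      b :: gamePath (fun q => σ (b :: q)) (fun q => τ (b :: q)) m p
  | 0, p => rfl
  | m+1, p => by
    simp only [gamePath, List.cons_append]
    exact gamePath_cons σ τ b m _

theorem gamePath_length (σ τ : List Bool → Bool) : ∀ (m : ℕ) (p : List Bool),
    (gamePath σ τ m p).length = p.length + m
  | 0, p => rfl
  | m+1, p => by
    simp only [gamePath]
    rw [gamePath_length σ τ m]
    simp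
    omega

theorem foldl_leaf (s : List Bool) : ∀ n : ℕ,
    s.foldl (fun n b => 2 * n + cond b 1 0) n = n * 2 ^ s.length + leafIdx s := by
  induction s with
  | nil => intro n; simp [leafIdx]
  | cons b s ih =>
    intro n
    have h1 := ih (2 * n + cond b 1 0)
    have h2 := ih (2 * 0 + cond b 1 0)
    simp only [leafIdx, List.foldl_cons, List.length_cons] at *
    rw [h1, h2]
    ring

theorem leafIdx_cons (b : Bool) (s : List Bool) :
    leafIdx (b :: s) = (cond b 1 0) * 2 ^ s.length + leafIdx s := by
  have := foldl_leaf s (2 * 0 + cond b 1 0)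
  simpa [leafIdx] using this

theorem leafIdx_lt (s : List Bool) : leafIdx s < 2 ^ s.length := by
  induction s with
  | nil => simp [leafIdx]
  | cons b s ih =>
    rw [leafIdx_cons, List.length_cons, pow_succ]
    cases b <;> simp only [cond_true, cond_false] <;> omega

theorem leafVal_cons (m : ℕ) (y : Fin (2^(m+1)) → Bool) (b : Bool) (s : List Bool)
    (hs : s.length = m) : leafVal (m+1) y (b :: s) = leafVal m (halfInput m b y) s := by
  subst hs
  have h1 := leafIdx_lt s
  have h2 := leafIdx_lt (b :: s)
  rw [List.length_cons] at h2
  unfold leafVal halfInput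
  rw [dif_pos h1, dif_pos h2]
  congr 2
  exact leafIdx_cons b s

theorem leaf_step (m : ℕ) (y : Fin (2^(m+1)) → Bool) (σ τ : List Bool → Bool) (b : Bool)
    (hb : (if (m+1) % 2 = 0 then σ [] else τ []) = b) :
    leafVal (m+1) y (gamePath σ τ (m+1) []) =
      leafVal m (halfInput m b y)
        (gamePath (fun q => σ (b :: q)) (fun q => τ (b :: q)) m []) := by
  simp only [gamePath, List.nil_append]
  rw [hb, gamePath_cons, leafVal_cons]
  rw [gamePath_length]; simp

theorem winning_even (m : ℕ) (hm : (m+1) % 2 = 0) (y : Fin (2^(m+1)) → Bool)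
    (σ : List Bool → Bool) :
    winning true (m+1) y σ ↔
      winning true m (halfInput m (σ []) y) (fun q => σ (σ [] :: q)) := by
  unfold winning
  simp only [if_true]
  constructor
  · intro H τ
    have := H (fun q => τ q.tail)
    rw [leaf_step m y σ _ (σ []) (by simp [hm])] at this
    exact this
  · intro H τ
    rw [leaf_step m y σ _ (σ []) (by simp [hm])]
    exact H _

theorem winning_odd (m : ℕ) (hm : ¬ (m+1) % 2 = 0) (y : Fin (2^(m+1)) → Bool)
    (σ : List Bool → Bool) :
    winning true (m+1) y σ ↔
      ∀ b, winning true m (halfInput m b y) (fun q => σ (b :: q)) := by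
  unfold winning
  simp only [if_true]
  constructor
  · intro H b τ
    have := H (fun q => if q = [] then b else τ q.tail)
    rw [leaf_step m y σ _ b (by rw [if_neg hm]; simp)] at this
    simpa using this
  · intro H τ
    rw [leaf_step m y σ _ (τ []) (by rw [if_neg hm])]
    exact H _ _

/-- Combine a first move and two substrategies. -/
def glue (b : Bool) (s : Bool → List Bool → Bool) : List Bool → Bool
  | [] => b
  | c :: q => s c q

theorem exists_winning : ∀ (m : ℕ) (y : Fin (2^m) → Bool), nand m y = true →
    ∃ σ, winning true m y σ
  | 0, y, h => by
    refine ⟨fun _ => true, fun τ => ?_⟩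
    simpa [leafVal, gamePath, leafIdx, nand] using h
  | m+1, y, h => by
    unfold nand at h
    split_ifs at h with hm
    · have : ∃ b, nand m (halfInput m b y) = true := by
        rcases Bool.or_eq_true_iff.mp h with h | h
        · exact ⟨_, h⟩
        · exact ⟨_, h⟩
      obtain ⟨b, hb⟩ := this
      obtain ⟨σ, hσ⟩ := exists_winning m _ hb
      exact ⟨glue b fun _ => σ, (winning_even m hm y _).2 hσ⟩
    · have h' := Bool.and_eq_true_iff.mp h
      obtain ⟨σ, hσ⟩ := exists_winning m _ h'.1
      obtain ⟨τ, hτ⟩ := exists_winning m _ h'.2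
      refine ⟨glue true fun b => if b then τ else σ, (winning_odd m hm y _).2 ?_⟩
      intro b
      cases b
      · exact hσ
      · exact hτ

theorem CZ_le {m : ℕ} {y : Fin (2^m) → Bool} {σ : List Bool → Bool}
    (hσ : winning true m y σ) : CZ true m y ≤ pathProd true σ m y := by
  rw [CZ]
  exact iInf₂_le σ hσ

theorem CZ_eq (m : ℕ) (y : Fin (2^m) → Bool) :
    CZ true m y = ⨅ σ : {σ // winning true m y σ}, pathProd true σ.1 m y := by
  rw [CZ, iInf_subtype]
  rfl

theorem CZ_odd (m : ℕ) (hm : ¬ (m+1) % 2 = 0) (y : Fin (2^(m+1)) → Bool) :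
    CZ true (m+1) y =
      (CZ true m (halfInput m false y) + CZ true m (halfInput m true y)) / 2 := by
  apply le_antisymm
  · rw [CZ_eq m, CZ_eq m, ENNReal.le_div_iff_mul_le (by simp) (by simp)]
    refine ENNReal.le_iInf_add_iInf fun σ τ => ?_
    rw [← ENNReal.le_div_iff_mul_le (by simp) (by simp)]
    have hw : winning true (m+1) y (glue true fun b => if b then τ.1 else σ.1) := by
      refine (winning_odd m hm y _).2 fun b => ?_
      cases b
      · exact σ.2
      · exact τ.2
    refine (CZ_le hw).trans ?_
    rw [pathProd, if_neg (by simpa using hm)]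
    exact le_rfl
  · rw [CZ_eq (m+1)]
    refine le_iInf fun σ => ?_
    have h := (winning_odd m hm y _).1 σ.2
    rw [pathProd, if_neg (by simpa using hm)]
    exact ENNReal.div_le_div_right (add_le_add (CZ_le (h false)) (CZ_le (h true))) _

theorem crit_ne_top (m : ℕ) (y : Fin (2^(m+2)) → Bool) : crit (m+2) y ≠ ⊤ := by
  rw [crit]
  split_ifs
  · simp
  · simp
  · generalize CZ _ m _ + CZ _ m _ = a
    generalize CZ _ m _ + CZ _ m _ = b
    intro h
    rw [ENNReal.div_eq_top] at h
    rcases h with ⟨h1, h2⟩ | ⟨h1, h2⟩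
    · simp [ENNReal.div_eq_zero_iff] at h1 h2
      simp [h2] at h1
    · apply h2
      rcases max_choice a b with h | h <;> rw [h] at h1 <;> rw [h1] <;> simp [ENNReal.top_div]

theorem CZ_even (m : ℕ) (hm : (m+1) % 2 = 0) (y : Fin (2^(m+1)) → Bool)
    (hc : crit (m+1) y ≠ ⊤) (h : nand (m+1) y = true) :
    CZ true (m+1) y = crit (m+1) y *
      min (CZ true m (halfInput m false y)) (CZ true m (halfInput m true y)) := by
  have hne : Nonempty {σ // winning true (m+1) y σ} := by
    obtain ⟨σ, hσ⟩ := exists_winning _ _ h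
    exact ⟨⟨σ, hσ⟩⟩
  have key : min (CZ true m (halfInput m false y)) (CZ true m (halfInput m true y)) =
      ⨅ σ : {σ // winning true (m+1) y σ},
        pathProd true (fun q => σ.1 (σ.1 [] :: q)) m (halfInput m (σ.1 []) y) := by
    apply le_antisymm
    · refine le_iInf fun σ => ?_
      have := CZ_le ((winning_even m hm y _).1 σ.2)
      refine le_trans ?_ this
      cases σ.1 []
      · exact min_le_left _ _
      · exact min_le_right _ _
    · have : ∀ b, (⨅ σ : {σ // winning true (m+1) y σ},
          pathProd true (fun q => σ.1 (σ.1 [] :: q)) m (halfInput m (σ.1 []) y)) ≤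
          CZ true m (halfInput m b y) := by
        intro b
        rw [CZ_eq m]
        refine le_iInf fun σ => ?_
        exact iInf_le_of_le ⟨glue b fun _ => σ.1, (winning_even m hm y _).2 σ.2⟩ le_rfl
      exact le_min (this _) (this _)
  rw [key, ENNReal.mul_iInf' (fun h => absurd h hc) (fun _ => hne), CZ_eq]
  refine iInf_congr fun σ => ?_
  rw [pathProd, if_pos (by simpa using hm)]

/-- For an A-winnable `x` of depth `2(d+1)` with root `r`:
`C_A(x) = (1/2) · c(r) · min_b (C_A(x^{b0}) + C_A(x^{b1}))`. -/
theorem CA_recursion (d : ℕ) (x : Fin (2^(2*d+2)) → Bool)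
    (h : nand (2*d+2) x = true) :
    CZ true (2*d+2) x =
      (1/2 : ℝ≥0∞) * crit (2*d+2) x *
        min (CZ true (2*d) (halfInput (2*d) false (halfInput (2*d+1) false x)) +
             CZ true (2*d) (halfInput (2*d) true (halfInput (2*d+1) false x)))
            (CZ true (2*d) (halfInput (2*d) false (halfInput (2*d+1) true x)) +
             CZ true (2*d) (halfInput (2*d) true (halfInput (2*d+1) true x))) := by
  rw [CZ_even (2*d+1) (by omega) x (crit_ne_top _ _) h, CZ_odd (2*d) (by omega),
    CZ_odd (2*d) (by omega)]
  have hmin : ∀ a b : ℝ≥0∞, min (a / 2) (b / 2) = min a b / 2 := by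
    intro a b
    have hmono : Monotone fun z : ℝ≥0∞ => z / 2 :=
      fun _ _ h => ENNReal.div_le_div_right h _
    exact (hmono.map_min).symm
  rw [hmin, one_div, div_eq_mul_inv]
  ring

end NandTree
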